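/- Define a sequence of integers by b₀ = −3, b₁ = 4, and b_{n+2} = 50·b_{n+1} − b_n for n ≥ 0. Then for every n ≥ 0 the integer 624·bₙ² + 625 is a perfect square; equivalently, writing Xₙ for its positive square root, (Xₙ, 5) is a positive integer solution of X² − (1 + bₙ²)·Y⁴ = −bₙ² for every n with bₙ ≠ 0. In particular, for a = 1 and these values b = |bₙ|, the equation X² − (a² + b²)·Y⁴ = −b² has a solution with Y = 5 fixed while b grows. -/

import Mathlib

/-- The recurrence sequence `b₀ = −3`, `b₁ = 4`, `b_{n+2} = 50·b_{n+1} − b_n`. -/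
def bseq : ℕ → ℤ
  | 0 => -3
  | 1 => 4
  | (n + 2) => 50 * bseq (n + 1) - bseq n

/-- The quadratic form `x² − 50xy + y²` is invariant along the recurrence. -/
theorem bseq_invariant (n : ℕ) :
    bseq n ^ 2 - 50 * bseq n * bseq (n + 1) + bseq (n + 1) ^ 2 = 625 := by
  induction n with
  | zero => norm_num [bseq]
  | succ n ih =>
    rw [show bseq (n + 1 + 1) = 50 * bseq (n + 1) - bseq n from rfl]
    linear_combination ih

/-- Remark after Lemma 3.4: For every `n ≥ 0`, the integer `624·bₙ² + 625` is a
perfect square; writing `Xₙ` for its positive square root, `(Xₙ, 5)` solves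
`X² − (1 + bₙ²)·Y⁴ = −bₙ²`. Thus for `a = 1` and these values of `b`, the equation
`X² − (a² + b²)·Y⁴ = −b²` has a solution with `Y = 5` fixed while `b` grows. -/
theorem recurrence_gives_fixed_Y_solutions :
    ∀ n : ℕ, ∃ X : ℤ, 0 < X ∧
      X ^ 2 = 624 * (bseq n) ^ 2 + 625 ∧
      X ^ 2 - (1 + (bseq n) ^ 2) * 5 ^ 4 = -(bseq n) ^ 2 := by
  intro n
  have hsq : (25 * bseq n - bseq (n + 1)) ^ 2 = 624 * bseq n ^ 2 + 625 := by
    linear_combination bseq_invariant n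
  refine ⟨|25 * bseq n - bseq (n + 1)|, abs_pos.mpr fun h => ?_, ?_, ?_⟩
  · rw [h] at hsq
    nlinarith [sq_nonneg (bseq n)]
  · rw [sq_abs, hsq]
  · rw [sq_abs, hsq]
    ring
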